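/- The Floer-type bipersistence module H_k^{(•,•]} of a Floer-type complex over a field is weakly-exact: for all a ≤ a' and b ≤ b' in ℝ, Im(H_k^{(a,b]} → H_k^{(a',b']}) = Im(H_k^{(a,b']} → H_k^{(a',b']}) ∩ Im(H_k^{(a',b]} → H_k^{(a',b']}), and Ker(H_k^{(a,b]} → H_k^{(a',b']}) = Ker(H_k^{(a,b]} → H_k^{(a,b']}) + Ker(H_k^{(a,b]} → H_k^{(a',b]}). -/

import Mathlib

/-- A Floer-type complex over a field `K` (trivial `Γ`): a chain complex of
`K`-vector spaces equipped with a filtration function `ℓ : C_* → ℝ ∪ {−∞}`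
satisfying `ℓ(x) = −∞ ↔ x = 0`, `ℓ(x+y) ≤ max (ℓ x) (ℓ y)`, `ℓ(c•x) = ℓ(x)` for
`c ≠ 0`, and `ℓ(∂x) ≤ ℓ(x)`. -/
structure FloerComplex (K : Type) [Field K] where
  C : ℤ → Type
  acg : ∀ k, AddCommGroup (C k)
  mod : ∀ k, Module K (C k)
  d : ∀ k : ℤ, C (k + 1) →ₗ[K] C k
  dd : ∀ (k : ℤ) (x : C (k + 1 + 1)), d k (d (k + 1) x) = 0
  ell : ∀ {k : ℤ}, C k → WithBot ℝ
  ell_bot : ∀ {k : ℤ} (x : C k), ell x = ⊥ ↔ x = 0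
  ell_add : ∀ {k : ℤ} (x y : C k), ell (x + y) ≤ max (ell x) (ell y)
  ell_smul : ∀ {k : ℤ} (c : K), c ≠ 0 → ∀ x : C k, ell (c • x) = ell x
  ell_d : ∀ (k : ℤ) (x : C (k + 1)), ell (d k x) ≤ ell x

attribute [instance] FloerComplex.acg FloerComplex.mod

namespace FloerComplex

variable {K : Type} [Field K] (X : FloerComplex K)

/-- The sublevel subcomplex `C^t = {x : ℓ(x) ≤ t}` in degree `k`. -/
def lvl (t : ℝ) (k : ℤ) : Submodule K (X.C k) where
  carrier := {x | X.ell x ≤ (t : WithBot ℝ)}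
  add_mem' {x y} hx hy := le_trans (X.ell_add x y) (max_le hx hy)
  zero_mem' := by
    have h : X.ell (0 : X.C k) = ⊥ := (X.ell_bot (0 : X.C k)).mpr rfl
    show X.ell (0 : X.C k) ≤ (t : WithBot ℝ)
    rw [h]; exact bot_le
  smul_mem' := by
    intro c x hx
    by_cases hc : c = 0
    · subst hc
      show X.ell ((0 : K) • x) ≤ (t : WithBot ℝ)
      rw [zero_smul, (X.ell_bot _).mpr rfl]
      exact bot_le
    · show X.ell (c • x) ≤ (t : WithBot ℝ)
      rw [X.ell_smul c hc x]
      exact hx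

lemma lvl_mono {s t : ℝ} (h : s ≤ t) (k : ℤ) : X.lvl s k ≤ X.lvl t k := by
  intro x hx
  exact le_trans hx (WithBot.coe_le_coe.mpr h)

/-- The interlevel (window) complex `C^{(a,b]} = C^b / C^a` in degree `k`. -/
abbrev win (a b : ℝ) (k : ℤ) :=
  ↥(X.lvl b k) ⧸ Submodule.comap (X.lvl b k).subtype (X.lvl a k)

/-- The differential restricted to a sublevel subcomplex. -/
def dLvl (t : ℝ) (k : ℤ) : ↥(X.lvl t (k + 1)) →ₗ[K] ↥(X.lvl t k) :=
  (X.d k).restrict (fun x hx => le_trans (X.ell_d k x) hx)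

/-- The differential of the window complex `C^{(a,b]}`. -/
def dWin (a b : ℝ) (k : ℤ) : X.win a b (k + 1) →ₗ[K] X.win a b k :=
  Submodule.mapQ _ _ (X.dLvl b k)
    (by
      intro x hx
      show ((X.dLvl b k x : X.C k)) ∈ X.lvl a k
      show X.ell (X.d k (x : X.C (k+1))) ≤ _
      exact le_trans (X.ell_d k (x : X.C (k+1))) hx)

/-- The canonical chain map `C^{(a,b]} → C^{(a',b']}` for `a ≤ a'`, `b ≤ b'`,
induced by the inclusion `C^b ⊆ C^{b'}`. -/
def winMap {a a' b b' : ℝ} (ha : a ≤ a') (hb : b ≤ b') (k : ℤ) :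
    X.win a b k →ₗ[K] X.win a' b' k :=
  Submodule.mapQ _ _ (Submodule.inclusion (X.lvl_mono hb k))
    (by
      intro x hx
      show ((Submodule.inclusion (X.lvl_mono hb k) x : X.C k)) ∈ X.lvl a' k
      exact X.lvl_mono ha k hx)

/-- Cycles of the window complex (in chain degree `k+1`). -/
def cyc (a b : ℝ) (k : ℤ) : Submodule K (X.win a b (k + 1)) :=
  LinearMap.ker (X.dWin a b k)

/-- Boundaries of the window complex (in chain degree `k+1`). -/
def bdry (a b : ℝ) (k : ℤ) : Submodule K (X.win a b (k + 1)) :=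
  LinearMap.range (X.dWin a b (k + 1))

/-- The interlevel filtered homology `H^{(a,b]}` (of the chain degree `k+1` part of
the window complex; as `k` ranges over `ℤ` this is all of the homology). -/
abbrev Hwin (a b : ℝ) (k : ℤ) :=
  ↥(X.cyc a b k) ⧸ Submodule.comap (X.cyc a b k).subtype (X.bdry a b k)

lemma winMap_dWin {a a' b b' : ℝ} (ha : a ≤ a') (hb : b ≤ b') (k : ℤ)
    (x : X.win a b (k + 1)) :
    X.winMap ha hb k (X.dWin a b k x) = X.dWin a' b' k (X.winMap ha hb (k + 1) x) := by
  obtain ⟨y, rfl⟩ := Submodule.Quotient.mk_surjective _ x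
  simp only [dWin, winMap, Submodule.mapQ_apply]
  rfl

lemma winMap_cyc {a a' b b' : ℝ} (ha : a ≤ a') (hb : b ≤ b') (k : ℤ) :
    ∀ x ∈ X.cyc a b k, X.winMap ha hb (k + 1) x ∈ X.cyc a' b' k := by
  intro x hx
  have h := X.winMap_dWin ha hb k x
  have hx0 : X.dWin a b k x = 0 := hx
  rw [hx0, map_zero] at h
  exact (h.symm : _)

/-- The induced map `H^{(a,b]} → H^{(a',b']}` on interlevel homology. -/
def Hmap {a a' b b' : ℝ} (ha : a ≤ a') (hb : b ≤ b') (k : ℤ) :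
    X.Hwin a b k →ₗ[K] X.Hwin a' b' k :=
  Submodule.mapQ _ _
    ((X.winMap ha hb (k + 1)).restrict (X.winMap_cyc ha hb k))
    (by
      intro x hx
      show (((X.winMap ha hb (k+1)).restrict (X.winMap_cyc ha hb k) x : X.win a' b' (k+1)))
        ∈ X.bdry a' b' k
      obtain ⟨y, hy⟩ := hx
      refine ⟨X.winMap ha hb (k + 1 + 1) y, ?_⟩
      show X.dWin a' b' (k+1) (X.winMap ha hb (k+1+1) y) = X.winMap ha hb (k+1) (x : X.win a b (k+1))
      rw [← X.winMap_dWin ha hb (k+1) y]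
      exact congrArg _ hy)

end FloerComplex

namespace FloerComplex

variable {K : Type} [Field K] (X : FloerComplex K)

/-- The chains of filtration level at most `b` whose boundary has level at most `a`. -/
def relCyc (a b : ℝ) (k : ℤ) : Submodule K (X.C (k + 1)) :=
  X.lvl b (k + 1) ⊓ (X.lvl a k).comap (X.d k)

/-- The class in the window complex of a relative cycle. -/
def relCycToCyc (a b : ℝ) (k : ℤ) : X.relCyc a b k →ₗ[K] X.cyc a b k :=
  LinearMap.codRestrict _ (Submodule.mkQ _ ∘ₗ Submodule.inclusion inf_le_left)
    (fun x => (Submodule.Quotient.mk_eq_zero _).mpr x.2.2)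

/-- The interlevel homology class of a relative cycle. -/
def homologyClass (a b : ℝ) (k : ℤ) : X.relCyc a b k →ₗ[K] X.Hwin a b k :=
  Submodule.mkQ _ ∘ₗ X.relCycToCyc a b k

lemma homologyClass_surjective (a b : ℝ) (k : ℤ) :
    Function.Surjective (X.homologyClass a b k) := by
  intro h
  obtain ⟨⟨z, hz⟩, rfl⟩ := Submodule.Quotient.mk_surjective _ h
  obtain ⟨x, rfl⟩ := Submodule.Quotient.mk_surjective _ z
  exact ⟨⟨x, x.2, (Submodule.Quotient.mk_eq_zero ((X.lvl a k).comap (X.lvl b k).subtype)).mp hz⟩,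
    rfl⟩

lemma homologyClass_eq_zero_iff {a b : ℝ} {k : ℤ} (x : X.relCyc a b k) :
    X.homologyClass a b k x = 0 ↔
      ∃ w ∈ X.lvl b (k + 1 + 1), (x : X.C (k + 1)) - X.d (k + 1) w ∈ X.lvl a (k + 1) := by
  refine (Submodule.Quotient.mk_eq_zero _).trans ⟨?_, ?_⟩
  · rintro ⟨q, hq⟩
    obtain ⟨w, rfl⟩ := Submodule.Quotient.mk_surjective _ q
    exact ⟨w, w.2, (Submodule.Quotient.eq
      ((X.lvl a (k + 1)).comap (X.lvl b (k + 1)).subtype)).mp hq.symm⟩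
  · rintro ⟨w, hw, h⟩
    exact ⟨Submodule.Quotient.mk ⟨w, hw⟩, ((Submodule.Quotient.eq
      ((X.lvl a (k + 1)).comap (X.lvl b (k + 1)).subtype)).mpr h).symm⟩

lemma relCyc_mono {a a' b b' : ℝ} (ha : a ≤ a') (hb : b ≤ b') (k : ℤ) :
    X.relCyc a b k ≤ X.relCyc a' b' k :=
  inf_le_inf (X.lvl_mono hb _) (Submodule.comap_mono (X.lvl_mono ha _))

lemma Hmap_homologyClass {a a' b b' : ℝ} (ha : a ≤ a') (hb : b ≤ b') (k : ℤ)
    (x : X.relCyc a b k) :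
    X.Hmap ha hb k (X.homologyClass a b k x) =
      X.homologyClass a' b' k (Submodule.inclusion (X.relCyc_mono ha hb k) x) :=
  rfl

lemma Hmap_comp {a a' a'' b b' b'' : ℝ} (ha : a ≤ a') (ha' : a' ≤ a'') (hb : b ≤ b')
    (hb' : b' ≤ b'') (k : ℤ) :
    X.Hmap ha' hb' k ∘ₗ X.Hmap ha hb k = X.Hmap (ha.trans ha') (hb.trans hb') k := by
  refine LinearMap.ext fun h => ?_
  obtain ⟨x, rfl⟩ := X.homologyClass_surjective a b k h
  rfl

lemma homologyClass_eq_zero_of_le {a b : ℝ} (h : b ≤ a) {k : ℤ} (x : X.relCyc a b k) :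
    X.homologyClass a b k x = 0 :=
  (X.homologyClass_eq_zero_iff x).mpr
    ⟨0, zero_mem _, by simpa using X.lvl_mono h _ x.2.1⟩

lemma range_Hmap_inf_le {a a' b b' : ℝ} (ha : a ≤ a') (hb : b ≤ b') (k : ℤ) :
    LinearMap.range (X.Hmap ha (le_refl b') k) ⊓ LinearMap.range (X.Hmap (le_refl a') hb k)
      ≤ LinearMap.range (X.Hmap ha hb k) := by
  rintro _ ⟨⟨p, rfl⟩, ⟨q, hq⟩⟩
  obtain ⟨u, rfl⟩ := X.homologyClass_surjective _ _ _ p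
  obtain ⟨v, rfl⟩ := X.homologyClass_surjective _ _ _ q
  rcases le_total b a' with h | h
  · rw [← hq, X.homologyClass_eq_zero_of_le h, map_zero]
    exact zero_mem _
  rw [Hmap_homologyClass, Hmap_homologyClass, ← sub_eq_zero, ← map_sub,
    homologyClass_eq_zero_iff] at hq
  obtain ⟨w, hw, hc⟩ := hq
  have hy : (u : X.C (k + 1)) + X.d (k + 1) w ∈ X.relCyc a b k := by
    constructor
    · simpa [sub_sub] using sub_mem v.2.1 (X.lvl_mono h _ hc)
    · change X.d k _ ∈ X.lvl a k
      rw [map_add, X.dd, add_zero]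
      exact u.2.2
  refine ⟨X.homologyClass a b k ⟨_, hy⟩, ?_⟩
  rw [Hmap_homologyClass, Hmap_homologyClass, ← sub_eq_zero, ← map_sub,
    homologyClass_eq_zero_iff]
  exact ⟨w, hw, by simp⟩

lemma ker_Hmap_le_sup {a a' b b' : ℝ} (ha : a ≤ a') (hb : b ≤ b') (k : ℤ) :
    LinearMap.ker (X.Hmap ha hb k)
      ≤ LinearMap.ker (X.Hmap (le_refl a) hb k) ⊔ LinearMap.ker (X.Hmap ha (le_refl b) k) := by
  intro p hp
  obtain ⟨y, rfl⟩ := X.homologyClass_surjective _ _ _ p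
  rcases le_total b a' with h | h
  · refine Submodule.mem_sup_right ?_
    rw [LinearMap.mem_ker, Hmap_homologyClass]
    exact X.homologyClass_eq_zero_of_le h _
  rw [LinearMap.mem_ker, Hmap_homologyClass, homologyClass_eq_zero_iff] at hp
  obtain ⟨w, hw, hc⟩ := hp
  rw [Submodule.coe_inclusion] at hc
  have hdw : X.d (k + 1) w ∈ X.relCyc a b k := by
    constructor
    · simpa using sub_mem y.2.1 (X.lvl_mono h _ hc)
    · change X.d k _ ∈ X.lvl a k
      rw [X.dd]
      exact zero_mem _
  rw [← add_sub_cancel (⟨_, hdw⟩ : X.relCyc a b k) y, map_add]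
  refine Submodule.add_mem_sup ?_ ?_
  · rw [LinearMap.mem_ker, Hmap_homologyClass, homologyClass_eq_zero_iff]
    exact ⟨w, hw, by simp⟩
  · rw [LinearMap.mem_ker, Hmap_homologyClass, homologyClass_eq_zero_iff]
    exact ⟨0, zero_mem _, by simpa using hc⟩

end FloerComplex

open FloerComplex in
/-- The Floer-type bipersistence module `H_k^{(•,•]}` of a Floer-type complex over a
field is weakly-exact: for all `a ≤ a'` and `b ≤ b'`,
`Im(H^{(a,b]} → H^{(a',b']}) = Im(H^{(a,b']} → H^{(a',b']}) ⊓ Im(H^{(a',b]} → H^{(a',b']})`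
and
`Ker(H^{(a,b]} → H^{(a',b']}) = Ker(H^{(a,b]} → H^{(a,b']}) ⊔ Ker(H^{(a,b]} → H^{(a',b]})`. -/
theorem floerBipersistence_weaklyExact {K : Type} [Field K] (X : FloerComplex K)
    (a a' b b' : ℝ) (ha : a ≤ a') (hb : b ≤ b') (k : ℤ) :
    (LinearMap.range (X.Hmap ha hb k)
      = LinearMap.range (X.Hmap ha (le_refl b') k)
        ⊓ LinearMap.range (X.Hmap (le_refl a') hb k)) ∧
    (LinearMap.ker (X.Hmap ha hb k)
      = LinearMap.ker (X.Hmap (le_refl a) hb k)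
        ⊔ LinearMap.ker (X.Hmap ha (le_refl b) k)) := by
  refine ⟨le_antisymm (le_inf ?_ ?_) (X.range_Hmap_inf_le ha hb k),
    le_antisymm (X.ker_Hmap_le_sup ha hb k) (sup_le ?_ ?_)⟩
  · rw [← X.Hmap_comp (le_refl a) ha hb (le_refl b') k]
    exact LinearMap.range_comp_le_range _ _
  · rw [← X.Hmap_comp ha (le_refl a') (le_refl b) hb k]
    exact LinearMap.range_comp_le_range _ _
  · rw [← X.Hmap_comp (le_refl a) ha hb (le_refl b') k]
    exact LinearMap.ker_le_ker_comp _ _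
  · rw [← X.Hmap_comp ha (le_refl a') (le_refl b) hb k]
    exact LinearMap.ker_le_ker_comp _ _
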